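/- In a strongly intransitive game, no learning algorithm can be a universal winner in an open-source competition: for every program code c such that c halts on (the encoding of) every opposing code, there exists an opposing code d such that d halts on the encoding of c, and the output of d on (encode c) defeats the output of c on (encode d), i.e. C p q = -1 where c.eval (encode d) = Part.some p and d.eval (encode c) = Part.some q. -/

import Mathlib

open Nat.Partrec (Code)
open Encodable (encode)

/-- In a strongly intransitive game (player 2 has a computable best response `S''`),
no learning algorithm can be a universal winner in an open-source competition. -/
theorem no_universal_winner_strongly_intransitive
    (C : ℕ → ℕ → ℤ) (hC : ∀ p q, C p q = -1 ∨ C p q = 0 ∨ C p q = 1)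
    (S'' : ℕ → ℕ) (hS'' : Computable S'') (hbeats : ∀ p, C p (S'' p) = -1) :
    ∀ c : Code, (∀ d : Code, (c.eval (encode d)).Dom) →
      ∃ d : Code, (d.eval (encode c)).Dom ∧
        ∀ p q : ℕ, c.eval (encode d) = Part.some p →
          d.eval (encode c) = Part.some q → C p q = -1 := by
  intro c hc
  have hresponse : Partrec₂ fun (d : Code) (_ : ℕ) => (c.eval (encode d)).map S'' :=
    (Code.eval_part.comp (.const c) (Computable.encode.comp .fst)).map (hS''.comp .snd)
  obtain ⟨d, hd⟩ := Code.fixed_point₂ hresponse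
  refine ⟨d, ?_, fun p q hp hq => ?_⟩
  · rw [hd]
    exact hc d
  · rw [hd, hp, Part.map_some, Part.some_inj] at hq
    exact hq ▸ hbeats p
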